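/- The product ×_α is not distributive over addition: with the irreducible normalized polynomial P := x₁² + x₂² and Q := x₂², one has P ×_α Q = (x₁² + x₂²)·x₂² + (2/3)ℏ², while x₁² ×_α x₂² = x₁²·x₂² and x₂² ×_α x₂² = x₂⁴; consequently (x₁² + x₂²) ×_α x₂² ≠ (x₁² ×_α x₂²) + (x₂² ×_α x₂²). -/

import Mathlib

/-- `N = ℝ[x₁,x₂,x₃]`, the polynomials in three real variables. -/
abbrev NPoly : Type := MvPolynomial (Fin 3) ℝ

/-- Partial derivative with respect to the `i`-th variable. -/
noncomputable def pd (i : Fin 3) : NPoly → NPoly :=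
  fun f => MvPolynomial.pderiv i f

/-- The `r`-th power of the Poisson bracket bidifferential operator in the
variables `(x₁,x₂)`:
`P^r(f,g) = Σ_{k=0}^{r} (-1)^k (r choose k) (∂₁^{r-k}∂₂^{k} f)·(∂₁^{k}∂₂^{r-k} g)`. -/
noncomputable def poissonPow (r : ℕ) (f g : NPoly) : NPoly :=
  ∑ k ∈ Finset.range (r + 1),
    ((-1 : ℝ) ^ k * (r.choose k : ℝ)) •
      ((pd 0)^[r - k] ((pd 1)^[k] f) * (pd 0)^[k] ((pd 1)^[r - k] g))

/-- The partial Moyal product of two polynomials: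
`f ∗ g = Σ_{r ≥ 0} (ℏ^r / r!) P^r(f,g)` (the sum is finite on polynomials:
all terms with `r > totalDegree f` vanish). -/
noncomputable def moyal0 (f g : NPoly) : Polynomial NPoly :=
  ∑ r ∈ Finset.range (f.totalDegree + 1),
    Polynomial.C ((r.factorial : ℝ)⁻¹ • poissonPow r f g) * Polynomial.X ^ r

/-- The `ℝ[ℏ]`-bilinear extension of the partial Moyal product to
`N[ℏ] = (ℝ[x₁,x₂,x₃])[ℏ]`. -/
noncomputable def moyal (F G : Polynomial NPoly) : Polynomial NPoly :=
  F.sum fun i a => G.sum fun j b => Polynomial.X ^ (i + j) * moyal0 a b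


/-- The deg-lex key of a monomial in three variables: monomials are compared
first by total degree and then lexicographically with respect to
`(x₁, x₂, x₃)` (for a fixed total degree the exponents of `x₁` and `x₂`
determine the monomial). -/
def degLexKey (d : Fin 3 →₀ ℕ) : Lex (ℕ × Lex (ℕ × ℕ)) :=
  toLex (d 0 + d 1 + d 2, toLex (d 0, d 1))

/-- Recover a monomial from its deg-lex key. -/
noncomputable def ofDegLexKey (p : Lex (ℕ × Lex (ℕ × ℕ))) : Fin 3 →₀ ℕ :=
  Finsupp.equivFunOnFinite.symm
    ![(ofLex (ofLex p).2).1, (ofLex (ofLex p).2).2,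
      (ofLex p).1 - (ofLex (ofLex p).2).1 - (ofLex (ofLex p).2).2]

/-- The maximal (deg-lex leading) monomial of a nonzero polynomial
`P ∈ ℝ[x₁,x₂,x₃]`, and `0` for the zero polynomial. -/
noncomputable def leadMonomial (P : MvPolynomial (Fin 3) ℝ) : Fin 3 →₀ ℕ :=
  if h : P = 0 then 0
  else
    ofDegLexKey
      ((P.support.image degLexKey).max'
        (Finset.Nonempty.image
          (Finset.nonempty_iff_ne_empty.mpr fun he =>
            h (MvPolynomial.support_eq_empty.mp he)) _))

/-- The deg-lex leading coefficient of a polynomial in `ℝ[x₁,x₂,x₃]`: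
the coefficient of its maximal monomial (and `0` for the zero
polynomial). -/
noncomputable def leadCoeff (P : MvPolynomial (Fin 3) ℝ) : ℝ :=
  P.coeff (leadMonomial P)

/-- The multiset of normalized (deg-lex leading coefficient `1`) irreducible
factors of a polynomial, obtained from a factorization into irreducibles by
scaling each factor to be normalized.  For a normalized polynomial `P` this
realizes the unique factorization `P = P₁ ⋯ Pₙ` into normalized irreducible
factors underlying the map `α̃(P) = P₁ ⊗ ⋯ ⊗ Pₙ`. -/
noncomputable def normFactors (u : NPoly) : Multiset NPoly :=
  (UniqueFactorizationMonoid.factors u).map fun q => (leadCoeff q)⁻¹ • q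

/-- The symmetrized Moyal evaluation of a list of polynomials:
`T(f₁ ⊗ ⋯ ⊗ fₙ) = (1/n!) Σ_{σ∈Sₙ} f_{σ(1)} ∗ ⋯ ∗ f_{σ(n)}`. -/
noncomputable def tsymList (l : List NPoly) : Polynomial NPoly :=
  (l.length.factorial : ℝ)⁻¹ •
    ∑ σ : Equiv.Perm (Fin l.length),
      (List.ofFn fun i => Polynomial.C (l.get (σ i))).foldl moyal 1

/-- The symmetrized Moyal evaluation map `T` on a multiset of (tensor)
factors; it is well defined since `tsymList` is invariant under
permutations of the list. -/
noncomputable def tsym (s : Multiset NPoly) : Polynomial NPoly :=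
  tsymList s.toList

/-- The Zariski product `×_α` on normalized polynomials:
`P ×_α Q = T(α̃(P) ⊗ α̃(Q))`, the symmetrized Moyal evaluation of the
concatenation of the normalized irreducible factors of `P` and of `Q`. -/
noncomputable def zariskiMul (u v : NPoly) : Polynomial NPoly :=
  tsym (normFactors u + normFactors v)

section

open MvPolynomial

/-! ### Iterated partial derivatives and the truncated Moyal product -/

lemma pd_eq_zero_of_totalDegree_eq_zero (i : Fin 3) {f : NPoly} (hf : f.totalDegree = 0) :
    pd i f = 0 := by
  rw [totalDegree_eq_zero_iff_eq_C.mp hf]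
  exact pderiv_C

lemma totalDegree_pd_le (i : Fin 3) (f : NPoly) : (pd i f).totalDegree ≤ f.totalDegree - 1 := by
  refine Finset.sup_le fun m hm => ?_
  have hm' : coeff (m + Finsupp.single i 1) f ≠ 0 := by
    intro h
    rw [mem_support_iff] at hm
    exact hm (by simp [pd, coeff_pderiv, h])
  have := le_totalDegree (mem_support_iff.mpr hm')
  rw [Finsupp.sum_add_index' (by simp) (by simp)] at this
  simp only [Finsupp.sum_single_index] at this
  lia

lemma totalDegree_iterate_pd_le (i : Fin 3) (n : ℕ) (f : NPoly) :
    ((pd i)^[n] f).totalDegree ≤ f.totalDegree - n := by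
  induction n with
  | zero => simp
  | succ n ih =>
    rw [Function.iterate_succ_apply']
    have := totalDegree_pd_le i ((pd i)^[n] f)
    lia

lemma iterate_pd_zero (i : Fin 3) (n : ℕ) : (pd i)^[n] 0 = 0 :=
  Function.iterate_fixed (map_zero (pderiv i)) n

lemma iterate_pd_eq_zero (i : Fin 3) {n : ℕ} {f : NPoly} (h : f.totalDegree < n) :
    (pd i)^[n] f = 0 := by
  obtain ⟨n, rfl⟩ := Nat.exists_eq_add_one_of_ne_zero (Nat.ne_zero_of_lt h)
  rw [Function.iterate_succ_apply']
  apply pd_eq_zero_of_totalDegree_eq_zero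
  have := totalDegree_iterate_pd_le i n f
  lia

lemma iterate_pd_iterate_pd_eq_zero (i j : Fin 3) {m n : ℕ} {f : NPoly}
    (h : f.totalDegree < m + n) : (pd i)^[m] ((pd j)^[n] f) = 0 := by
  by_cases hn : f.totalDegree < n
  · rw [iterate_pd_eq_zero j hn, iterate_pd_zero]
  · apply iterate_pd_eq_zero
    have := totalDegree_iterate_pd_le j n f
    lia

lemma poissonPow_eq_zero_left {r : ℕ} {f : NPoly} (g : NPoly) (h : f.totalDegree < r) :
    poissonPow r f g = 0 := by
  refine Finset.sum_eq_zero fun k hk => ?_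
  rw [Finset.mem_range] at hk
  rw [iterate_pd_iterate_pd_eq_zero 0 1 (f := f) (by lia), zero_mul, smul_zero]

lemma poissonPow_eq_zero_right {r : ℕ} (f : NPoly) {g : NPoly} (h : g.totalDegree < r) :
    poissonPow r f g = 0 := by
  refine Finset.sum_eq_zero fun k hk => ?_
  rw [Finset.mem_range] at hk
  rw [iterate_pd_iterate_pd_eq_zero 0 1 (f := g) (by lia), mul_zero, smul_zero]

lemma moyal0_eq_sum_range_of_forall (f g : NPoly) {n : ℕ}
    (h : ∀ r, n ≤ r → poissonPow r f g = 0) :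
    moyal0 f g = ∑ r ∈ Finset.range n,
      Polynomial.C ((r.factorial : ℝ)⁻¹ • poissonPow r f g) * Polynomial.X ^ r := by
  rw [moyal0]
  rcases le_total n (f.totalDegree + 1) with hn | hn
  · refine (Finset.sum_subset (Finset.range_mono hn) fun r _ hr => ?_).symm
    rw [h r (by simpa using hr)]
    simp
  · refine Finset.sum_subset (Finset.range_mono hn) fun r _ hr => ?_
    rw [poissonPow_eq_zero_left g (by simpa using hr)]
    simp

lemma moyal0_eq_sum_range (f : NPoly) {g : NPoly} {n : ℕ} (hg : g.totalDegree < n) :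
    moyal0 f g = ∑ r ∈ Finset.range n,
      Polynomial.C ((r.factorial : ℝ)⁻¹ • poissonPow r f g) * Polynomial.X ^ r :=
  moyal0_eq_sum_range_of_forall f g fun _ hr => poissonPow_eq_zero_right f (hg.trans_le hr)

lemma pd_add (i : Fin 3) (f g : NPoly) : pd i (f + g) = pd i f + pd i g :=
  map_add (pderiv i) f g

lemma iterate_pd_add (i : Fin 3) (n : ℕ) (f g : NPoly) :
    (pd i)^[n] (f + g) = (pd i)^[n] f + (pd i)^[n] g := by
  induction n with
  | zero => rfl
  | succ n ih => simp only [Function.iterate_succ_apply', ih, pd_add]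

lemma poissonPow_add_left (r : ℕ) (f₁ f₂ g : NPoly) :
    poissonPow r (f₁ + f₂) g = poissonPow r f₁ g + poissonPow r f₂ g := by
  simp only [poissonPow, iterate_pd_add, add_mul, smul_add, Finset.sum_add_distrib]

lemma moyal0_add_left (f₁ f₂ g : NPoly) :
    moyal0 (f₁ + f₂) g = moyal0 f₁ g + moyal0 f₂ g := by
  simp only [moyal0_eq_sum_range _ (Nat.lt_succ_self g.totalDegree), poissonPow_add_left,
    smul_add, map_add, add_mul, Finset.sum_add_distrib]

lemma moyal0_zero_left (g : NPoly) : moyal0 0 g = 0 := by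
  simpa using moyal0_add_left 0 0 g

lemma moyal0_zero_right (f : NPoly) : moyal0 f 0 = 0 := by
  rw [moyal0_eq_sum_range f (n := 1) (by simp)]
  simp [poissonPow]

lemma moyal_C_right (F : Polynomial NPoly) (g : NPoly) :
    moyal F (Polynomial.C g) = F.sum fun i a => Polynomial.X ^ i * moyal0 a g := by
  simp [moyal, Polynomial.sum_C_index, moyal0_zero_right]

lemma moyal_add_left (F G : Polynomial NPoly) (g : NPoly) :
    moyal (F + G) (Polynomial.C g) = moyal F (Polynomial.C g) + moyal G (Polynomial.C g) := by
  simp only [moyal_C_right]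
  exact Polynomial.sum_add_index _ _ _ (by simp [moyal0_zero_left])
    (by simp [moyal0_add_left, mul_add])

lemma moyal_C_mul_X_pow (a : NPoly) (i : ℕ) (g : NPoly) :
    moyal (Polynomial.C a * Polynomial.X ^ i) (Polynomial.C g) =
      Polynomial.X ^ i * moyal0 a g := by
  rw [moyal_C_right, Polynomial.C_mul_X_pow_eq_monomial, Polynomial.sum_monomial_index]
  simp [moyal0_zero_left]

lemma moyal0_X_zero (f : NPoly) :
    moyal0 f (X 0) = Polynomial.C (f * X 0) + Polynomial.C (-pderiv 1 f) * Polynomial.X := by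
  rw [moyal0_eq_sum_range f (n := 2) (by simp)]
  simp [Finset.sum_range_succ, poissonPow, pd]

lemma moyal0_X_one (f : NPoly) :
    moyal0 f (X 1) = Polynomial.C (f * X 1) + Polynomial.C (pderiv 0 f) * Polynomial.X := by
  rw [moyal0_eq_sum_range f (n := 2) (by simp)]
  simp [Finset.sum_range_succ, poissonPow, pd]

lemma moyal0_sq_add_sq (f : NPoly) :
    moyal0 f (X 0 ^ 2 + X 1 ^ 2) = Polynomial.C (f * (X 0 ^ 2 + X 1 ^ 2)) +
      Polynomial.C (2 * (pderiv 0 f * X 1 - pderiv 1 f * X 0)) * Polynomial.X +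
      Polynomial.C (pderiv 0 (pderiv 0 f) + pderiv 1 (pderiv 1 f)) * Polynomial.X ^ 2 := by
  have hdeg : (X 0 ^ 2 + X 1 ^ 2 : NPoly).totalDegree < 3 :=
    (totalDegree_add _ _).trans_lt (by simp [totalDegree_X_pow])
  have h1 : poissonPow 1 f (X 0 ^ 2 + X 1 ^ 2) = 2 * (pderiv 0 f * X 1 - pderiv 1 f * X 0) := by
    simp [Finset.sum_range_succ, poissonPow, pd]
    ring
  have hC : (2 : NPoly) = C 2 := (map_ofNat C 2).symm
  have h2 : (2⁻¹ : ℝ) • poissonPow 2 f (X 0 ^ 2 + X 1 ^ 2) =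
      pderiv 0 (pderiv 0 f) + pderiv 1 (pderiv 1 f) := by
    rw [inv_smul_eq_iff₀ two_ne_zero, smul_eq_C_mul]
    simp [Finset.sum_range_succ, poissonPow, pd, hC]
    ring
  have h0 : poissonPow 0 f (X 0 ^ 2 + X 1 ^ 2) = f * (X 0 ^ 2 + X 1 ^ 2) := by
    simp [poissonPow]
  rw [moyal0_eq_sum_range f hdeg]
  simp [-map_add, -map_mul, -map_sub, Finset.sum_range_succ, h0, h1, h2, Nat.factorial]

/-- The element `a + b ℏ + c ℏ²` of `N[ℏ]`. -/
noncomputable def hbarQuad (a b c : NPoly) : Polynomial NPoly :=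
  Polynomial.C a + Polynomial.C b * Polynomial.X + Polynomial.C c * Polynomial.X ^ 2

lemma hbarQuad_congr {a a' b b' c c' : NPoly} (ha : a = a') (hb : b = b') (hc : c = c') :
    hbarQuad a b c = hbarQuad a' b' c' := by
  rw [ha, hb, hc]

lemma moyal_hbarQuad (a b c g : NPoly) :
    moyal (hbarQuad a b c) (Polynomial.C g) =
      moyal0 a g + Polynomial.X * moyal0 b g + Polynomial.X ^ 2 * moyal0 c g := by
  have h0 := moyal_C_mul_X_pow a 0 g
  have h1 := moyal_C_mul_X_pow b 1 g
  rw [pow_zero, mul_one, one_mul] at h0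
  rw [pow_one] at h1
  rw [hbarQuad, moyal_add_left, moyal_add_left, h0, h1, moyal_C_mul_X_pow]

lemma one_eq_hbarQuad : (1 : Polynomial NPoly) = hbarQuad 1 0 0 := by
  simp [hbarQuad]

lemma moyal_hbarQuad_X_zero (a b c : NPoly) (hc : pderiv 1 c = 0) :
    moyal (hbarQuad a b c) (Polynomial.C (X 0)) =
      hbarQuad (a * X 0) (b * X 0 - pderiv 1 a) (c * X 0 - pderiv 1 b) := by
  rw [moyal_hbarQuad]
  simp only [moyal0_X_zero, hc, hbarQuad, map_sub, map_neg, map_zero]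
  ring

lemma moyal_hbarQuad_X_one (a b c : NPoly) (hc : pderiv 0 c = 0) :
    moyal (hbarQuad a b c) (Polynomial.C (X 1)) =
      hbarQuad (a * X 1) (b * X 1 + pderiv 0 a) (c * X 1 + pderiv 0 b) := by
  rw [moyal_hbarQuad]
  simp only [moyal0_X_one, hc, hbarQuad, map_add, map_zero]
  ring

lemma moyal_hbarQuad_sq_add_sq (a : NPoly) :
    moyal (hbarQuad a 0 0) (Polynomial.C (X 0 ^ 2 + X 1 ^ 2)) =
      hbarQuad (a * (X 0 ^ 2 + X 1 ^ 2)) (2 * (pderiv 0 a * X 1 - pderiv 1 a * X 0))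
        (pderiv 0 (pderiv 0 a) + pderiv 1 (pderiv 1 a)) := by
  rw [moyal_hbarQuad, moyal0_sq_add_sq, moyal0_zero_left, hbarQuad]
  ring

/-! ### Symmetrized evaluation -/

lemma tsymList_eq_of_perm {l l' : List NPoly} (h : l.Perm l') : tsymList l = tsymList l' := by
  classical
  obtain ⟨e, he⟩ : ∃ e : Fin l.length ≃ Fin l'.length, ∀ i, l'.get (e i) = l.get i :=
    ⟨⟨h.idxBij, h.symm.idxBij, h.idxBij_rightInverse_idxBij_symm,
      h.idxBij_leftInverse_idxBij_symm⟩, fun i => h.getElem_idxBij_eq_getElem i⟩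
  have hword : ∀ {n m : ℕ} (e : Fin n ≃ Fin m) (f : Fin n → NPoly) (g : Fin m → NPoly),
      (∀ i, g (e i) = f i) →
      (n.factorial : ℝ)⁻¹ • ∑ σ : Equiv.Perm (Fin n),
        (List.ofFn fun i => Polynomial.C (f (σ i))).foldl moyal 1 =
      (m.factorial : ℝ)⁻¹ • ∑ σ : Equiv.Perm (Fin m),
        (List.ofFn fun i => Polynomial.C (g (σ i))).foldl moyal 1 := by
    intro n m e f g hfg
    obtain rfl : n = m := Fin.equiv_iff_eq.mp ⟨e⟩
    congr 1
    exact Fintype.sum_equiv (Equiv.mulLeft (e : Equiv.Perm (Fin n))) _ _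
      fun σ => by simp [← hfg]
  exact hword e l.get l'.get he

lemma tsym_coe (l : List NPoly) : tsym (l : Multiset NPoly) = tsymList l :=
  tsymList_eq_of_perm (Multiset.coe_eq_coe.mp (Multiset.coe_toList _))

lemma sum_perm_fin_three {M : Type*} [AddCommMonoid M] (w : (Fin 3 → Fin 3) → M) :
    ∑ σ : Equiv.Perm (Fin 3), w σ =
      (([
        ![0, 1, 2], ![0, 2, 1], ![1, 0, 2], ![1, 2, 0], ![2, 0, 1], ![2, 1, 0]]
        : List (Fin 3 → Fin 3)).map w).sum := by
  have h : (Finset.univ : Finset (Equiv.Perm (Fin 3))).val.map (fun σ => (σ : Fin 3 → Fin 3)) =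
      ([
        ![0, 1, 2], ![0, 2, 1], ![1, 0, 2], ![1, 2, 0], ![2, 0, 1], ![2, 1, 0]]
        : List (Fin 3 → Fin 3)) := by
    decide
  rw [← Multiset.sum_coe, ← Multiset.map_coe, ← h, Multiset.map_map]
  rfl

lemma sum_perm_fin_four {M : Type*} [AddCommMonoid M] (w : (Fin 4 → Fin 4) → M) :
    ∑ σ : Equiv.Perm (Fin 4), w σ =
      (([
        ![0, 1, 2, 3], ![0, 1, 3, 2], ![0, 2, 1, 3], ![0, 2, 3, 1], ![0, 3, 1, 2],
        ![0, 3, 2, 1], ![1, 0, 2, 3], ![1, 0, 3, 2], ![1, 2, 0, 3], ![1, 2, 3, 0],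
        ![1, 3, 0, 2], ![1, 3, 2, 0], ![2, 0, 1, 3], ![2, 0, 3, 1], ![2, 1, 0, 3],
        ![2, 1, 3, 0], ![2, 3, 0, 1], ![2, 3, 1, 0], ![3, 0, 1, 2], ![3, 0, 2, 1],
        ![3, 1, 0, 2], ![3, 1, 2, 0], ![3, 2, 0, 1], ![3, 2, 1, 0]]
        : List (Fin 4 → Fin 4)).map w).sum := by
  have h : (Finset.univ : Finset (Equiv.Perm (Fin 4))).val.map (fun σ => (σ : Fin 4 → Fin 4)) =
      ([
        ![0, 1, 2, 3], ![0, 1, 3, 2], ![0, 2, 1, 3], ![0, 2, 3, 1], ![0, 3, 1, 2],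
        ![0, 3, 2, 1], ![1, 0, 2, 3], ![1, 0, 3, 2], ![1, 2, 0, 3], ![1, 2, 3, 0],
        ![1, 3, 0, 2], ![1, 3, 2, 0], ![2, 0, 1, 3], ![2, 0, 3, 1], ![2, 1, 0, 3],
        ![2, 1, 3, 0], ![2, 3, 0, 1], ![2, 3, 1, 0], ![3, 0, 1, 2], ![3, 0, 2, 1],
        ![3, 1, 0, 2], ![3, 1, 2, 0], ![3, 2, 0, 1], ![3, 2, 1, 0]]
        : List (Fin 4 → Fin 4)) := by
    decide
  rw [← Multiset.sum_coe, ← Multiset.map_coe, ← h, Multiset.map_map]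
  rfl

/-- The iterated Moyal product `f₁ ∗ ⋯ ∗ fₙ`, associated to the left. -/
noncomputable def moyalWord (l : List NPoly) : Polynomial NPoly :=
  (l.map Polynomial.C).foldl moyal (hbarQuad 1 0 0)

lemma tsymList_eq_sum_moyalWord (l : List NPoly) :
    tsymList l = (l.length.factorial : ℝ)⁻¹ •
      ∑ σ : Equiv.Perm (Fin l.length), moyalWord (List.ofFn fun i => l.get (σ i)) := by
  simp only [tsymList, moyalWord, one_eq_hbarQuad, List.map_ofFn]
  rfl

lemma tsymList_three (a b c : NPoly) :
    tsymList [a, b, c] = (6 : ℝ)⁻¹ • [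
      moyalWord [a, b, c], moyalWord [a, c, b], moyalWord [b, a, c], moyalWord [b, c, a],
      moyalWord [c, a, b], moyalWord [c, b, a]].sum := by
  rw [tsymList_eq_sum_moyalWord]
  refine (congrArg _ (sum_perm_fin_three fun σ =>
    moyalWord (List.ofFn fun i => [a, b, c].get (σ i)))).trans ?_
  simp only [List.map, List.ofFn_succ, List.ofFn_zero, Nat.factorial, List.length]
  norm_num
  rfl

lemma tsymList_four (a b c d : NPoly) :
    tsymList [a, b, c, d] = (24 : ℝ)⁻¹ • [
      moyalWord [a, b, c, d], moyalWord [a, b, d, c], moyalWord [a, c, b, d],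
      moyalWord [a, c, d, b], moyalWord [a, d, b, c], moyalWord [a, d, c, b],
      moyalWord [b, a, c, d], moyalWord [b, a, d, c], moyalWord [b, c, a, d],
      moyalWord [b, c, d, a], moyalWord [b, d, a, c], moyalWord [b, d, c, a],
      moyalWord [c, a, b, d], moyalWord [c, a, d, b], moyalWord [c, b, a, d],
      moyalWord [c, b, d, a], moyalWord [c, d, a, b], moyalWord [c, d, b, a],
      moyalWord [d, a, b, c], moyalWord [d, a, c, b], moyalWord [d, b, a, c],
      moyalWord [d, b, c, a], moyalWord [d, c, a, b], moyalWord [d, c, b, a]].sum := by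
  rw [tsymList_eq_sum_moyalWord]
  refine (congrArg _ (sum_perm_fin_four fun σ =>
    moyalWord (List.ofFn fun i => [a, b, c, d].get (σ i)))).trans ?_
  simp only [List.map, List.ofFn_succ, List.ofFn_zero, Nat.factorial, List.length]
  norm_num
  rfl

lemma natCast_smul (n : ℕ) (F : Polynomial NPoly) : (n : ℝ) • F = n * F := by
  rw [Nat.cast_smul_eq_nsmul, nsmul_eq_mul]

lemma inv_smul_eq_of_eq_natCast_mul {c : ℝ} {n : ℕ} (hc : c = n) (hn : n ≠ 0)
    {F G : Polynomial NPoly} (h : F = n * G) : c⁻¹ • F = G := by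
  rw [h, hc, inv_smul_eq_iff₀ (Nat.cast_ne_zero.mpr hn), natCast_smul]

lemma pderiv_two (i : Fin 3) : pderiv i (2 : NPoly) = 0 := by
  rw [← map_ofNat C 2, pderiv_C]

lemma tsymList_sq_add_sq :
    tsymList [X 0 ^ 2 + X 1 ^ 2, X 1, X 1] =
      Polynomial.C ((X 0 ^ 2 + X 1 ^ 2 : NPoly) * X 1 ^ 2) +
        ((2 : ℝ) / 3) • Polynomial.X ^ 2 := by
  have h1 : moyalWord [X 0 ^ 2 + X 1 ^ 2, X 1, X 1] =
      hbarQuad ((X 0 ^ 2 + X 1 ^ 2) * X 1 ^ 2) (4 * X 0 * X 1) 2 := by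
    simp only [moyalWord, List.map, List.foldl]
    rw [moyal_hbarQuad_sq_add_sq, moyal_hbarQuad_X_one _ _ _ (by simp),
      moyal_hbarQuad_X_one _ _ _ (by simp)]
    refine hbarQuad_congr ?_ ?_ ?_ <;> simp [pderiv_two] <;> ring
  have h2 : moyalWord [X 1, X 0 ^ 2 + X 1 ^ 2, X 1] =
      hbarQuad ((X 0 ^ 2 + X 1 ^ 2) * X 1 ^ 2) 0 (-2) := by
    simp only [moyalWord, List.map, List.foldl]
    rw [moyal_hbarQuad_X_one _ _ _ (by simp)]
    simp only [pderiv_one, zero_mul, map_zero, add_zero, one_mul]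
    rw [moyal_hbarQuad_sq_add_sq, moyal_hbarQuad_X_one _ _ _ (by simp)]
    exact hbarQuad_congr (by ring) (by simp; ring) (by simp [pderiv_two])
  have h3 : moyalWord [X 1, X 1, X 0 ^ 2 + X 1 ^ 2] =
      hbarQuad ((X 0 ^ 2 + X 1 ^ 2) * X 1 ^ 2) (-(4 * X 0 * X 1)) 2 := by
    simp only [moyalWord, List.map, List.foldl]
    rw [moyal_hbarQuad_X_one _ _ _ (by simp)]
    simp only [pderiv_one, zero_mul, map_zero, add_zero, one_mul]
    rw [moyal_hbarQuad_X_one _ _ _ (by simp)]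
    simp only [pderiv_X_of_ne (one_ne_zero : (1 : Fin 3) ≠ 0), zero_mul, map_zero, add_zero]
    rw [moyal_hbarQuad_sq_add_sq]
    exact hbarQuad_congr (by ring) (by simp; ring) (by simp; ring)
  rw [tsymList_three]
  simp only [h1, h2, h3, List.sum_cons, List.sum_nil]
  have hX : ((3 : ℕ) : Polynomial NPoly) * (((2 : ℝ) / 3) • Polynomial.X ^ 2) =
      ((2 : ℕ) : Polynomial NPoly) * Polynomial.X ^ 2 := by
    rw [← natCast_smul, ← natCast_smul, smul_smul]
    norm_num
  refine inv_smul_eq_of_eq_natCast_mul (n := 6) (by norm_num) (by norm_num) ?_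
  push_cast at hX ⊢
  simp only [hbarQuad, map_neg, map_zero, map_ofNat]
  linear_combination -2 * hX

lemma tsymList_X_zero_X_one :
    tsymList [X 0, X 0, X 1, X 1] = Polynomial.C ((X 0 ^ 2 : NPoly) * X 1 ^ 2) := by
  have h1 : moyalWord [X 0, X 0, X 1, X 1] =
      hbarQuad (X 0 ^ 2 * X 1 ^ 2) (4 * X 0 * X 1) 2 := by
    simp [moyalWord, moyal_hbarQuad_X_one, moyal_hbarQuad_X_zero, -map_mul]
    refine hbarQuad_congr ?_ ?_ ?_ <;> ring
  have h2 : moyalWord [X 0, X 1, X 0, X 1] =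
      hbarQuad (X 0 ^ 2 * X 1 ^ 2) (2 * X 0 * X 1) 0 := by
    simp [moyalWord, moyal_hbarQuad_X_one, moyal_hbarQuad_X_zero, -map_mul]
    refine hbarQuad_congr ?_ ?_ ?_ <;> ring
  have h3 : moyalWord [X 0, X 1, X 1, X 0] =
      hbarQuad (X 0 ^ 2 * X 1 ^ 2) 0 (-2) := by
    simp [moyalWord, moyal_hbarQuad_X_one, moyal_hbarQuad_X_zero, -map_mul]
    refine hbarQuad_congr ?_ ?_ ?_ <;> ring
  have h4 : moyalWord [X 1, X 0, X 0, X 1] =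
      hbarQuad (X 0 ^ 2 * X 1 ^ 2) 0 (-2) := by
    simp [moyalWord, moyal_hbarQuad_X_one, moyal_hbarQuad_X_zero, -map_mul]
    refine hbarQuad_congr ?_ ?_ ?_ <;> ring
  have h5 : moyalWord [X 1, X 0, X 1, X 0] =
      hbarQuad (X 0 ^ 2 * X 1 ^ 2) (-(2 * X 0 * X 1)) 0 := by
    simp [moyalWord, moyal_hbarQuad_X_one, moyal_hbarQuad_X_zero, -map_mul]
    refine hbarQuad_congr ?_ ?_ ?_ <;> ring
  have h6 : moyalWord [X 1, X 1, X 0, X 0] =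
      hbarQuad (X 0 ^ 2 * X 1 ^ 2) (-(4 * X 0 * X 1)) 2 := by
    simp [moyalWord, moyal_hbarQuad_X_one, moyal_hbarQuad_X_zero, -map_mul]
    refine hbarQuad_congr ?_ ?_ ?_ <;> ring
  rw [tsymList_four]
  simp only [h1, h2, h3, h4, h5, h6, List.sum_cons, List.sum_nil]
  refine inv_smul_eq_of_eq_natCast_mul (n := 24) (by norm_num) (by norm_num) ?_
  simp only [hbarQuad, map_neg, map_zero, map_ofNat]
  push_cast
  ring

lemma tsymList_X_one :
    tsymList [X 1, X 1, X 1, X 1] = Polynomial.C ((X 1 : NPoly) ^ 4) := by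
  have h : moyalWord [X 1, X 1, X 1, X 1] = hbarQuad (X 1 ^ 4) 0 0 := by
    simp [moyalWord, moyal_hbarQuad_X_one, -map_mul]
    exact hbarQuad_congr (by ring) rfl rfl
  rw [tsymList_four]
  simp only [h, List.sum_cons, List.sum_nil]
  refine inv_smul_eq_of_eq_natCast_mul (n := 24) (by norm_num) (by norm_num) ?_
  simp only [hbarQuad, map_zero]
  push_cast
  ring

/-! ### Normalized factorizations -/

lemma ofDegLexKey_degLexKey (d : Fin 3 →₀ ℕ) : ofDegLexKey (degLexKey d) = d := by
  ext i
  fin_cases i <;> simp [ofDegLexKey, degLexKey]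
  lia

lemma leadMonomial_eq_of_forall_le {P : NPoly} {d : Fin 3 →₀ ℕ} (hd : d ∈ P.support)
    (h : ∀ e ∈ P.support, degLexKey e ≤ degLexKey d) : leadMonomial P = d := by
  have hP : P ≠ 0 := by
    rintro rfl
    simp at hd
  rw [leadMonomial, dif_neg hP]
  refine Eq.trans (congrArg _ ?_) (ofDegLexKey_degLexKey d)
  exact le_antisymm (Finset.max'_le _ _ _ (by simpa using h))
    (Finset.le_max' _ _ (Finset.mem_image_of_mem _ hd))

lemma leadCoeff_smul {c : ℝ} (hc : c ≠ 0) (P : NPoly) : leadCoeff (c • P) = c * leadCoeff P := by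
  have hs : (c • P).support = P.support := by
    ext m
    simp [hc]
  have : leadMonomial (c • P) = leadMonomial P := by
    simp only [leadMonomial, hs, smul_eq_zero, hc, false_or]
  rw [leadCoeff, leadCoeff, this, coeff_smul, smul_eq_mul]

lemma leadCoeff_X (i : Fin 3) : leadCoeff (X i) = 1 := by
  have : leadMonomial (X i) = Finsupp.single i 1 :=
    leadMonomial_eq_of_forall_le (by simp) (by simp [support_X])
  simp [leadCoeff, this]

lemma leadCoeff_sq_add_sq : leadCoeff (X 0 ^ 2 + X 1 ^ 2) = 1 := by
  have hcoeff : coeff (Finsupp.single 0 2) (X 0 ^ 2 + X 1 ^ 2 : NPoly) = 1 := by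
    rw [coeff_add, coeff_X_pow, coeff_X_pow, if_pos rfl, if_neg, add_zero]
    intro h
    simpa using DFunLike.congr_fun h 0
  have hlead : leadMonomial (X 0 ^ 2 + X 1 ^ 2) = Finsupp.single 0 2 := by
    refine leadMonomial_eq_of_forall_le (by simp [hcoeff]) fun e he => ?_
    have he' := support_add he
    rw [support_X_pow, support_X_pow, Finset.mem_union, Finset.mem_singleton,
      Finset.mem_singleton] at he'
    rcases he' with rfl | rfl
    · exact le_rfl
    · simp [degLexKey, Prod.Lex.toLex_le_toLex]
  rw [leadCoeff, hlead, hcoeff]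

lemma normalize_eq_of_associated {p q : NPoly} (hp : leadCoeff p = 1) (h : Associated q p) :
    (leadCoeff q)⁻¹ • q = p := by
  obtain ⟨u, hu⟩ := h.symm
  obtain ⟨c, hc, hcu⟩ := (MvPolynomial.isUnit_iff_eq_C_of_isReduced).mp u.isUnit
  have hq : q = c • p := by rw [← hu, hcu, smul_eq_C_mul, mul_comm]
  rw [hq, leadCoeff_smul hc.ne_zero, hp, mul_one, inv_smul_smul₀ hc.ne_zero]

lemma normFactors_prod {s : Multiset NPoly} (hs : ∀ p ∈ s, Irreducible p)
    (hs' : ∀ p ∈ s, leadCoeff p = 1) : normFactors s.prod = s := by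
  have h0 : s.prod ≠ 0 := Multiset.prod_ne_zero fun h => (hs 0 h).ne_zero rfl
  have hrel : Multiset.Rel Associated (UniqueFactorizationMonoid.factors s.prod) s :=
    UniqueFactorizationMonoid.factors_unique
      (fun _ => UniqueFactorizationMonoid.irreducible_of_factor _) hs
      (UniqueFactorizationMonoid.factors_prod h0)
  rw [normFactors, ← Multiset.rel_eq, Multiset.rel_map_left]
  exact hrel.mono fun q _ p hp h => normalize_eq_of_associated (hs' p hp) h

lemma irreducible_sq_add_sq : Irreducible (X 0 ^ 2 + X 1 ^ 2 : NPoly) := by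
  rw [← MulEquiv.irreducible_iff (finSuccEquiv ℝ 2)]
  have hp : finSuccEquiv ℝ 2 (X 0 ^ 2 + X 1 ^ 2) =
      Polynomial.X ^ 2 + Polynomial.C (X 0 ^ 2) := by
    rw [map_add, map_pow, map_pow, finSuccEquiv_X_zero, ← Fin.succ_zero_eq_one,
      finSuccEquiv_X_succ, map_pow]
  rw [hp]
  have hdeg := Polynomial.natDegree_X_pow_add_C (n := 2) (r := (X 0 ^ 2 : MvPolynomial (Fin 2) ℝ))
  rw [(Polynomial.monic_X_pow_add_C _ two_ne_zero).irreducible_iff_roots_eq_zero_of_degree_le_three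
    hdeg.ge (hdeg.le.trans (by norm_num)), Multiset.eq_zero_iff_forall_notMem]
  intro r hr
  have h := congrArg (eval fun _ => (1 : ℝ)) (Polynomial.isRoot_of_mem_roots hr)
  simp at h
  nlinarith [sq_nonneg (eval (fun _ => (1 : ℝ)) r)]

lemma normFactors_X_sq (i : Fin 3) : normFactors (X i ^ 2) = {X i, X i} := by
  have := normFactors_prod (s := {X i, X i}) (by simp [(X_prime (R := ℝ) (i := i)).irreducible])
    (by simp [leadCoeff_X])
  simpa [sq] using this

lemma normFactors_sq_add_sq :
    normFactors (X 0 ^ 2 + X 1 ^ 2) = {X 0 ^ 2 + X 1 ^ 2} := by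
  have := normFactors_prod (s := {X 0 ^ 2 + X 1 ^ 2}) (by simpa using irreducible_sq_add_sq)
    (by simpa using leadCoeff_sq_add_sq)
  simpa using this

lemma zariskiMul_sq_add_sq_X_one_sq :
    zariskiMul (X 0 ^ 2 + X 1 ^ 2) (X 1 ^ 2) =
      Polynomial.C ((X 0 ^ 2 + X 1 ^ 2 : NPoly) * X 1 ^ 2) +
        ((2 : ℝ) / 3) • Polynomial.X ^ 2 := by
  rw [zariskiMul, normFactors_sq_add_sq, normFactors_X_sq]
  exact (tsym_coe [X 0 ^ 2 + X 1 ^ 2, X 1, X 1]).trans tsymList_sq_add_sq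

lemma zariskiMul_X_zero_sq_X_one_sq :
    zariskiMul (X 0 ^ 2) (X 1 ^ 2) = Polynomial.C ((X 0 ^ 2 : NPoly) * X 1 ^ 2) := by
  rw [zariskiMul, normFactors_X_sq, normFactors_X_sq]
  exact (tsym_coe [X 0, X 0, X 1, X 1]).trans tsymList_X_zero_X_one

lemma zariskiMul_X_one_sq_X_one_sq :
    zariskiMul (X 1 ^ 2) (X 1 ^ 2) = Polynomial.C ((X 1 : NPoly) ^ 4) := by
  rw [zariskiMul, normFactors_X_sq]
  exact (tsym_coe [X 1, X 1, X 1, X 1]).trans tsymList_X_one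

end

/-- The product `×_α` is not distributive over addition:
with the irreducible normalized `P = x₁² + x₂²` and `Q = x₂²` one has
`P ×_α Q = (x₁² + x₂²)·x₂² + (2/3)ℏ²`, while `x₁² ×_α x₂² = x₁²·x₂²` and
`x₂² ×_α x₂² = x₂⁴`; consequently
`(x₁² + x₂²) ×_α x₂² ≠ (x₁² ×_α x₂²) + (x₂² ×_α x₂²)`. -/
theorem zariskiMul_not_distributive :
    Irreducible ((MvPolynomial.X 0 ^ 2 + MvPolynomial.X 1 ^ 2 : NPoly)) ∧
    leadCoeff (MvPolynomial.X 0 ^ 2 + MvPolynomial.X 1 ^ 2) = 1 ∧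
    zariskiMul (MvPolynomial.X 0 ^ 2 + MvPolynomial.X 1 ^ 2) (MvPolynomial.X 1 ^ 2) =
      Polynomial.C ((MvPolynomial.X 0 ^ 2 + MvPolynomial.X 1 ^ 2 : NPoly) *
          MvPolynomial.X 1 ^ 2) +
        ((2 : ℝ) / 3) • Polynomial.X ^ 2 ∧
    zariskiMul (MvPolynomial.X 0 ^ 2) (MvPolynomial.X 1 ^ 2) =
      Polynomial.C ((MvPolynomial.X 0 ^ 2 : NPoly) * MvPolynomial.X 1 ^ 2) ∧
    zariskiMul (MvPolynomial.X 1 ^ 2) (MvPolynomial.X 1 ^ 2) =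
      Polynomial.C ((MvPolynomial.X 1 : NPoly) ^ 4) ∧
    zariskiMul (MvPolynomial.X 0 ^ 2 + MvPolynomial.X 1 ^ 2) (MvPolynomial.X 1 ^ 2) ≠
      zariskiMul (MvPolynomial.X 0 ^ 2) (MvPolynomial.X 1 ^ 2) +
        zariskiMul (MvPolynomial.X 1 ^ 2) (MvPolynomial.X 1 ^ 2) := by
  refine ⟨irreducible_sq_add_sq, leadCoeff_sq_add_sq, zariskiMul_sq_add_sq_X_one_sq,
    zariskiMul_X_zero_sq_X_one_sq, zariskiMul_X_one_sq_X_one_sq, fun h => ?_⟩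
  rw [zariskiMul_sq_add_sq_X_one_sq, zariskiMul_X_zero_sq_X_one_sq,
    zariskiMul_X_one_sq_X_one_sq] at h
  have h2 := congrArg (fun F => Polynomial.coeff F 2) h
  simp only [Polynomial.coeff_add, Polynomial.coeff_smul, Polynomial.coeff_X_pow_self,
    Polynomial.coeff_C_of_ne_zero two_ne_zero, zero_add, add_zero] at h2
  exact absurd h2 (smul_ne_zero (by norm_num) one_ne_zero)
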